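/- Let G be a digraph on N, let I be the set of sinks of G (vertices with no out-neighbors), and let I' = {i : g_ij = 1 for some j ∈ I}. Let H be the induced subdigraph of G on N∖(I ∪ I'). Let e be a specialized equilibrium of the public goods game on G and let e|_H denote its restriction to the players in H. Then e is a stable equilibrium of the game on G if and only if e|_H is a stable specialized equilibrium of the game on H. -/

import Mathlib

/-- `e` is a specialized equilibrium of the public goods game on the digraph with
finite vertex type `V` and adjacency `g`, with threshold `e* > 0`: each player
contributes `0` when the spillovers received reach `e*`, and `e*` otherwise. -/
def IsSpecEq {V : Type*} [Finite V] (g : V → V → ℝ) (estar : ℝ) (e : V → ℝ) : Prop :=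
  ∀ i, (estar ≤ ∑ᶠ j, g i j * e j → e i = 0) ∧ (∑ᶠ j, g i j * e j < estar → e i = estar)

/-- The best-response map of the public goods game on the digraph `g` with
threshold `e*`: `f i (e) = max (0, e* - ∑ j, g i j * e j)`. -/
noncomputable def brMap {V : Type*} [Finite V] (g : V → V → ℝ) (estar : ℝ)
    (e : V → ℝ) : V → ℝ :=
  fun i => max 0 (estar - ∑ᶠ j, g i j * e j)

/-- `e` is a stable equilibrium of the public goods game on `g`: for some `ρ > 0`,
the best-response iterates from any legitimate perturbation of `e` of size at most
`ρ` converge back to `e`. -/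
def StableEq {V : Type*} [Finite V] (g : V → V → ℝ) (estar : ℝ) (e : V → ℝ) : Prop :=
  ∃ ρ > (0 : ℝ), ∀ ε : V → ℝ,
    (∀ i, |ε i| ≤ ρ) → (∀ i, 0 ≤ e i + ε i) →
    Filter.Tendsto (fun r : ℕ => (brMap g estar)^[r] (fun i => e i + ε i))
      Filter.atTop (nhds e)

section BestResponse

variable {V : Type*} {g : V → V → ℝ} {estar : ℝ} {I I' : Set V} {x e : V → ℝ}

/-- A nonnegative profile in which every player in `I` contributes `estar` and every
player in `I'` contributes nothing. -/
structure Settled (estar : ℝ) (I I' : Set V) (x : V → ℝ) : Prop where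
  nonneg : ∀ i, 0 ≤ x i
  eq_on_sinks : ∀ i ∈ I, x i = estar
  eq_zero : ∀ i ∈ I', x i = 0

/-- In a settled profile the players outside `I ∪ I'` receive spillovers only from each
other. -/
lemma Settled.spillover_restrict (hH : ∀ i ∉ I', ∀ j ∈ I, g i j = 0)
    (hx : Settled estar I I' x) (v : {i : V // i ∉ I ∪ I'}) :
    ∑ᶠ w : {i : V // i ∉ I ∪ I'}, g v.1 w.1 * x w.1 = ∑ᶠ j, g v.1 j * x j := by
  classical
  refine (finsum_set_coe_eq_finsum_mem (f := fun j => g v.1 j * x j) (I ∪ I')ᶜ).trans ?_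
  refine finsum_congr fun j => ?_
  by_cases hj : j ∈ (I ∪ I')ᶜ
  · rw [finsum_eq_if, if_pos hj]
  · rw [finsum_eq_if, if_neg hj]
    rcases not_not.mp hj with hj | hj
    · rw [hH v.1 (fun h => v.2 (Or.inr h)) j hj, zero_mul]
    · rw [hx.eq_zero j hj, mul_zero]

variable [Finite V]

lemma brMap_nonneg (g : V → V → ℝ) (estar : ℝ) (x : V → ℝ) (i : V) :
    0 ≤ brMap g estar x i :=
  le_max_left _ _

lemma continuous_brMap (g : V → V → ℝ) (estar : ℝ) : Continuous (brMap g estar) := by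
  have := Fintype.ofFinite V
  unfold brMap
  simp only [finsum_eq_sum_of_fintype]
  fun_prop

lemma le_spillover (hg : ∀ i j, 0 ≤ g i j) (hx : ∀ i, 0 ≤ x i) (i j : V) :
    g i j * x j ≤ ∑ᶠ k, g i k * x k := by
  have := Fintype.ofFinite V
  rw [finsum_eq_sum_of_fintype]
  exact Finset.single_le_sum (f := fun k => g i k * x k)
    (fun k _ => mul_nonneg (hg i k) (hx k)) (Finset.mem_univ j)

lemma brMap_eq_of_sink (hestar : 0 < estar) {i : V} (hi : ∀ j, g i j = 0) :
    brMap g estar x i = estar := by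
  simp [brMap, hi, hestar.le]

lemma brMap_eq_zero_of_dominator (hg : ∀ i j, 0 ≤ g i j) (hx : ∀ i, 0 ≤ x i) {i j : V}
    (hij : g i j = 1) (hj : x j = estar) : brMap g estar x i = 0 := by
  have := le_spillover hg hx i j
  rw [hij, hj, one_mul] at this
  exact max_eq_left (by linarith)

lemma settled_brMap (hg : ∀ i j, 0 ≤ g i j) (hestar : 0 < estar)
    (hI : ∀ i ∈ I, ∀ j, g i j = 0) (hI' : ∀ i ∈ I', ∃ j ∈ I, g i j = 1)
    (hx : ∀ i, 0 ≤ x i) (hxI : ∀ i ∈ I, x i = estar) :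
    Settled estar I I' (brMap g estar x) where
  nonneg := brMap_nonneg g estar x
  eq_on_sinks i hi := brMap_eq_of_sink hestar (hI i hi)
  eq_zero i hi := by
    obtain ⟨j, hj, hij⟩ := hI' i hi
    exact brMap_eq_zero_of_dominator hg hx hij (hxI j hj)

lemma settled_brMap_brMap (hg : ∀ i j, 0 ≤ g i j) (hestar : 0 < estar)
    (hI : ∀ i ∈ I, ∀ j, g i j = 0) (hI' : ∀ i ∈ I', ∃ j ∈ I, g i j = 1) :
    Settled estar I I' (brMap g estar (brMap g estar x)) :=
  settled_brMap hg hestar hI hI' (brMap_nonneg g estar x)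
    (fun i hi => brMap_eq_of_sink hestar (hI i hi))

lemma Settled.iterate (hg : ∀ i j, 0 ≤ g i j) (hestar : 0 < estar)
    (hI : ∀ i ∈ I, ∀ j, g i j = 0) (hI' : ∀ i ∈ I', ∃ j ∈ I, g i j = 1)
    (hx : Settled estar I I' x) (r : ℕ) : Settled estar I I' ((brMap g estar)^[r] x) := by
  induction r with
  | zero => exact hx
  | succ r ih =>
    rw [Function.iterate_succ_apply']
    exact settled_brMap hg hestar hI hI' ih.nonneg ih.eq_on_sinks

lemma Settled.iterate_restrict (hg : ∀ i j, 0 ≤ g i j) (hestar : 0 < estar)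
    (hI : ∀ i ∈ I, ∀ j, g i j = 0) (hI' : ∀ i ∈ I', ∃ j ∈ I, g i j = 1)
    (hH : ∀ i ∉ I', ∀ j ∈ I, g i j = 0) (hx : Settled estar I I' x) (r : ℕ) :
    (brMap (fun a b : {i : V // i ∉ I ∪ I'} => g a.1 b.1) estar)^[r] (fun v => x v.1) =
      fun v => (brMap g estar)^[r] x v.1 := by
  induction r with
  | zero => rfl
  | succ r ih =>
    rw [Function.iterate_succ_apply', Function.iterate_succ_apply', ih]
    funext v
    simp only [brMap]
    rw [(hx.iterate hg hestar hI hI' r).spillover_restrict hH v]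

lemma Settled.tendsto_iterate_iff (hg : ∀ i j, 0 ≤ g i j) (hestar : 0 < estar)
    (hI : ∀ i ∈ I, ∀ j, g i j = 0) (hI' : ∀ i ∈ I', ∃ j ∈ I, g i j = 1)
    (hH : ∀ i ∉ I', ∀ j ∈ I, g i j = 0) (hx : Settled estar I I' x)
    (he : Settled estar I I' e) :
    Filter.Tendsto (fun r : ℕ => (brMap g estar)^[r] x) Filter.atTop (nhds e) ↔
      Filter.Tendsto (fun r : ℕ =>
        (brMap (fun a b : {i : V // i ∉ I ∪ I'} => g a.1 b.1) estar)^[r] (fun v => x v.1))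
        Filter.atTop (nhds fun v => e v.1) := by
  simp only [hx.iterate_restrict hg hestar hI hI' hH, tendsto_pi_nhds]
  refine ⟨fun h v => h v.1, fun h i => ?_⟩
  have hr := hx.iterate hg hestar hI hI'
  by_cases hi : i ∈ I ∪ I'
  · rcases hi with hi | hi
    · simp only [(hr _).eq_on_sinks i hi, he.eq_on_sinks i hi, tendsto_const_nhds]
    · simp only [(hr _).eq_zero i hi, he.eq_zero i hi, tendsto_const_nhds]
  · exact h ⟨i, hi⟩

lemma IsSpecEq.eq_zero_or_eq (he : IsSpecEq g estar e) (i : V) : e i = 0 ∨ e i = estar :=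
  (le_or_gt estar (∑ᶠ j, g i j * e j)).imp (he i).1 (he i).2

lemma IsSpecEq.nonneg (hestar : 0 < estar) (he : IsSpecEq g estar e) (i : V) : 0 ≤ e i := by
  rcases he.eq_zero_or_eq i with h | h <;> rw [h]
  exact hestar.le

lemma IsSpecEq.brMap_eq (hg01 : ∀ i j, g i j = 0 ∨ g i j = 1) (hg : ∀ i j, 0 ≤ g i j)
    (hestar : 0 < estar) (he : IsSpecEq g estar e) : brMap g estar e = e := by
  funext i
  rcases le_or_gt estar (∑ᶠ j, g i j * e j) with h | h
  · rw [(he i).1 h]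
    exact max_eq_left (by linarith)
  · have hz : ∀ j, g i j * e j = 0 := fun j => by
      have hle := le_spillover hg (he.nonneg hestar) i j
      rcases hg01 i j with h0 | h1
      · rw [h0, zero_mul]
      · rcases he.eq_zero_or_eq j with h2 | h2
        · rw [h2, mul_zero]
        · rw [h1, h2] at hle
          linarith
    rw [(he i).2 h]
    simp [brMap, hz, hestar.le]

end BestResponse

/-- Let `I` be the set of sinks of `g` (vertices with no
out-neighbors), `I'` the set of vertices with an out-neighbor in `I`, and `H` the
induced subdigraph on the complement of `I ∪ I'`. A specialized equilibrium `e` of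
the game on `g` is stable iff its restriction to the players of `H` is a stable
specialized equilibrium of the game on `H`. -/
theorem stable_iff_stable_without_sinks_and_dominators
    {n : ℕ} (g : Fin n → Fin n → ℝ)
    (hg01 : ∀ i j, g i j = 0 ∨ g i j = 1) (hgdiag : ∀ i, g i i = 0)
    (estar : ℝ) (hestar : 0 < estar)
    (I I' : Set (Fin n))
    (hI : I = {i | ∀ j, g i j = 0})
    (hI' : I' = {i | ∃ j ∈ I, g i j = 1})
    (e : Fin n → ℝ) (he : IsSpecEq g estar e) :
    StableEq g estar e ↔
      (IsSpecEq (fun a b : {i : Fin n // i ∉ I ∪ I'} => g a.1 b.1) estar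
          (fun v => e v.1) ∧
       StableEq (fun a b : {i : Fin n // i ∉ I ∪ I'} => g a.1 b.1) estar
          (fun v => e v.1)) := by
  have hg : ∀ i j, 0 ≤ g i j := fun i j => by rcases hg01 i j with h | h <;> simp [h]
  have hsink : ∀ i ∈ I, ∀ j, g i j = 0 := fun i hi => by rwa [hI] at hi
  have hdom : ∀ i ∈ I', ∃ j ∈ I, g i j = 1 := fun i hi => by rwa [hI'] at hi
  have hH : ∀ i ∉ I', ∀ j ∈ I, g i j = 0 := fun i hi j hj =>
    (hg01 i j).resolve_right fun h => hi (by rw [hI']; exact ⟨j, hj, h⟩)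
  have hfix : brMap g estar e = e := he.brMap_eq hg01 hg hestar
  have hset : Settled estar I I' e := by
    have h := settled_brMap_brMap (x := e) hg hestar hsink hdom
    rwa [hfix, hfix] at h
  have hspec : IsSpecEq (fun a b : {i : Fin n // i ∉ I ∪ I'} => g a.1 b.1) estar
      (fun v => e v.1) := fun v => by
    rw [hset.spillover_restrict hH v]
    exact he v.1
  constructor
  · rintro ⟨ρ, hρ, h⟩
    refine ⟨hspec, ρ, hρ, fun ε hε hpos => ?_⟩
    classical
    set ε' : Fin n → ℝ := fun i => if hi : i ∉ I ∪ I' then ε ⟨i, hi⟩ else 0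
    have hin : ∀ i ∈ I ∪ I', ε' i = 0 := fun i hi => dif_neg (not_not.mpr hi)
    have hout : ∀ v : {i : Fin n // i ∉ I ∪ I'}, ε' v.1 = ε v := fun v => dif_pos v.2
    have hpos' : ∀ i, 0 ≤ e i + ε' i := fun i => by
      by_cases hi : i ∈ I ∪ I'
      · rw [hin i hi, add_zero]
        exact hset.nonneg i
      · rw [hout ⟨i, hi⟩]
        exact hpos ⟨i, hi⟩
    have hx : Settled estar I I' (fun i => e i + ε' i) :=
      ⟨hpos', fun i hi => by rw [hin i (Or.inl hi), add_zero, hset.eq_on_sinks i hi],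
        fun i hi => by rw [hin i (Or.inr hi), add_zero, hset.eq_zero i hi]⟩
    have hlim := h ε' (fun i => by
      by_cases hi : i ∈ I ∪ I'
      · rw [hin i hi, abs_zero]
        exact hρ.le
      · rw [hout ⟨i, hi⟩]
        exact hε ⟨i, hi⟩) hpos'
    rw [hx.tendsto_iterate_iff hg hestar hsink hdom hH hset] at hlim
    simpa only [hout] using hlim
  · rintro ⟨-, ρ, hρ, h⟩
    have hcont : ContinuousAt (brMap g estar ∘ brMap g estar) e :=
      ((continuous_brMap g estar).comp (continuous_brMap g estar)).continuousAt
    obtain ⟨δ, hδ, hclose⟩ := Metric.continuousAt_iff.mp hcont ρ hρ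
    refine ⟨δ / 2, half_pos hδ, fun ε hε _ => ?_⟩
    set y := brMap g estar (brMap g estar fun i => e i + ε i)
    have hys : Settled estar I I' y := settled_brMap_brMap hg hestar hsink hdom
    have hdist : dist y e < ρ := by
      have hd : dist (fun i => e i + ε i) e < δ := by
        refine lt_of_le_of_lt ((dist_pi_le_iff (half_pos hδ).le).mpr fun i => ?_)
          (half_lt_self hδ)
        simpa [Real.dist_eq] using hε i
      simpa only [Function.comp_apply, hfix] using hclose hd
    rw [← Filter.tendsto_add_atTop_iff_nat 2]
    simp only [Function.iterate_add_apply]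
    change Filter.Tendsto (fun r : ℕ => (brMap g estar)^[r] y) Filter.atTop (nhds e)
    rw [hys.tendsto_iterate_iff hg hestar hsink hdom hH hset]
    have hlim := h (fun v => y v.1 - e v.1)
      (fun v => (dist_le_pi_dist y e v.1).trans hdist.le)
      (fun v => by simpa using hys.nonneg v.1)
    simpa only [add_sub_cancel] using hlim
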